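/- arXiv:1911.00150 — 4 statements merged into one kernel-verified Lean document; each statement's English description precedes it below -/
import Mathlib

section
/- Let T > 0 and I = [−T, T] with |I| = 2T ≥ 1, and let G : ℝ^N → [0,∞) be a G-function. Let u : I → ℝ^N be absolutely continuous with almost-everywhere derivative u̇ such that t ↦ G(u̇(t)) and t ↦ G(u(t)) are integrable on I. Then for every t ∈ I one has ∫_I G(u̇(s)) ds + ∫_I G(u(s)) ds ≥ 2 G(u(t) / (2|I|)). -/
open Filter MeasureTheory

lemma ConvexOn.le_mul_of_map_zero {E : Type*} [AddCommGroup E] [Module ℝ E] {G : E → ℝ}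
    (hG : ConvexOn ℝ Set.univ G) (hG0 : G 0 = 0) {c : ℝ} (h0 : 0 ≤ c) (h1 : c ≤ 1) (x : E) :
    G (c • x) ≤ c * G x := by
  have h := hG.2 (Set.mem_univ x) (Set.mem_univ 0) h0 (sub_nonneg.2 h1) (by ring)
  simpa [hG0] using h

/-- Jensen's inequality for `f` extended by zero from a measurable subset `A` of `B`. -/
lemma ConvexOn.map_smul_setIntegral_le {α E : Type*} [MeasurableSpace α] {μ : Measure α}
    [NormedAddCommGroup E] [NormedSpace ℝ E] [CompleteSpace E] {G : E → ℝ}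
    (hG : ConvexOn ℝ Set.univ G) (hcont : Continuous G) (hnonneg : ∀ x, 0 ≤ G x) (hG0 : G 0 = 0)
    {A B : Set α} (hA : MeasurableSet A) (hAB : A ⊆ B) (hB0 : μ B ≠ 0) (hB : μ B ≠ ⊤)
    {f : α → E} (hf : IntegrableOn f B μ) (hGf : IntegrableOn (fun s => G (f s)) B μ) :
    G ((μ.real B)⁻¹ • ∫ s in A, f s ∂μ) ≤ (μ.real B)⁻¹ * ∫ s in B, G (f s) ∂μ := by
  have hcomp : G ∘ A.indicator f = A.indicator (fun s => G (f s)) := by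
    funext s
    by_cases hs : s ∈ A <;> simp [hs, hG0]
  have h := hG.map_set_average_le hcont.continuousOn isClosed_univ hB0 hB
    (f := A.indicator f) (by simp) (hf.indicator hA) (by
      rw [hcomp]
      exact hGf.indicator hA)
  have hcomp' : (fun s => G (A.indicator f s)) = A.indicator (fun s => G (f s)) := hcomp
  rw [hcomp', setAverage_eq, setAverage_eq, setIntegral_indicator hA, setIntegral_indicator hA,
    Set.inter_eq_right.2 hAB, smul_eq_mul] at h
  refine h.trans (mul_le_mul_of_nonneg_left ?_ (by positivity))
  exact setIntegral_mono_set hGf (Eventually.of_forall fun s => hnonneg _) hAB.eventuallyLE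

/-- Lemma: if `|I| = 2T ≥ 1`, then `R_G(u̇) + R_G(u) ≥ 2 G(u(t)/(2|I|))` for all `t ∈ I`. -/
theorem modular_ge_G_of_periodicSobolev
    {N : ℕ} (G : EuclideanSpace ℝ (Fin N) → ℝ)
    (hGnonneg : ∀ x, 0 ≤ G x)
    (hGconvex : ConvexOn ℝ Set.univ G)
    (hGeven : ∀ x, G (-x) = G x)
    (hG0 : G 0 = 0)
    (hGsuper : Tendsto (fun x : EuclideanSpace ℝ (Fin N) => G x / ‖x‖)
      (Filter.comap norm atTop) atTop)
    (T : ℝ) (hT : 0 < T) (hI : 1 ≤ 2 * T)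
    (u u' : ℝ → EuclideanSpace ℝ (Fin N))
    (hu'int : IntervalIntegrable u' volume (-T) T)
    (hAC : ∀ t ∈ Set.Icc (-T) T, u t = u (-T) + ∫ s in (-T)..t, u' s)
    (hGu' : IntegrableOn (fun s => G (u' s)) (Set.Icc (-T) T))
    (hGu : IntegrableOn (fun s => G (u s)) (Set.Icc (-T) T)) :
    ∀ t ∈ Set.Icc (-T) T,
      2 * G ((2 * (2 * T))⁻¹ • u t) ≤
        (∫ s in Set.Icc (-T) T, G (u' s)) + ∫ s in Set.Icc (-T) T, G (u s) := by
  intro t ht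
  have hcont : Continuous G := continuousOn_univ.1 (hGconvex.continuousOn isOpen_univ)
  have hvol : volume.real (Set.Icc (-T) T) = 2 * T := by
    rw [Real.volume_real_Icc_of_le (by linarith)]
    ring
  have hL : (2 * T)⁻¹ ≤ 1 := inv_le_one_of_one_le₀ hI
  have hL0 : 0 ≤ (2 * T)⁻¹ := by positivity
  have hu'on : IntegrableOn u' (Set.Icc (-T) T) :=
    (intervalIntegrable_iff_integrableOn_Icc_of_le (by linarith)).1 hu'int
  set K := ∫ s in Set.Icc (-T) T, G (u' s)
  have hM0 : 0 ≤ ∫ s in Set.Icc (-T) T, G (u s) := integral_nonneg fun s => hGnonneg _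
  have hincr : ∀ s ∈ Set.Icc (-T) T, u t = u s + ∫ r in s..t, u' r := by
    intro s hs
    have hsub : ∀ r ∈ Set.Icc (-T) T, IntervalIntegrable u' volume (-T) r := fun r hr =>
      hu'int.mono_set (by
        rw [Set.uIcc_of_le hr.1, Set.uIcc_of_le (hr.1.trans hr.2)]
        exact Set.Icc_subset_Icc_right hr.2)
    rw [hAC t ht, hAC s hs, add_assoc,
      intervalIntegral.integral_add_adjacent_intervals (hsub s hs)
        ((hsub s hs).symm.trans (hsub t ht))]
  have hjensen : ∀ s ∈ Set.Icc (-T) T,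
      G ((2 * T)⁻¹ • ∫ r in s..t, u' r) ≤ (2 * T)⁻¹ * K := by
    intro s hs
    have h := hGconvex.map_smul_setIntegral_le (μ := volume) hcont hGnonneg hG0
      (measurableSet_uIoc (a := s) (b := t))
      (Set.uIoc_subset_uIcc.trans (Set.uIcc_subset_Icc hs ht))
      (by simp [hT]) (by simp) hu'on hGu'
    rw [hvol] at h
    refine le_trans (le_of_eq ?_) h
    rcases le_total s t with hst | hst
    · rw [intervalIntegral.integral_of_le hst, Set.uIoc_of_le hst]
    · rw [intervalIntegral.integral_of_ge hst, Set.uIoc_of_ge hst, smul_neg, hGeven]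
  have hpoint : ∀ s ∈ Set.Icc (-T) T,
      2 * G ((2 * (2 * T))⁻¹ • u t) ≤ (2 * T)⁻¹ * G (u s) + (2 * T)⁻¹ * K := by
    intro s hs
    have hsplit : (2 * (2 * T))⁻¹ • u t
        = (1 / 2 : ℝ) • ((2 * T)⁻¹ • u s) + (1 / 2 : ℝ) • ((2 * T)⁻¹ • ∫ r in s..t, u' r) := by
      rw [hincr s hs, ← smul_add, ← smul_add, smul_smul, mul_inv, one_div]
    have hmid := hGconvex.2 (Set.mem_univ ((2 * T)⁻¹ • u s))
      (Set.mem_univ ((2 * T)⁻¹ • ∫ r in s..t, u' r))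
      (by norm_num : (0 : ℝ) ≤ 1 / 2) (by norm_num : (0 : ℝ) ≤ 1 / 2) (by norm_num)
    rw [← hsplit, smul_eq_mul, smul_eq_mul] at hmid
    have h1 := hGconvex.le_mul_of_map_zero hG0 hL0 hL (u s)
    have h2 := hjensen s hs
    linarith
  have hmono := setIntegral_mono_on (μ := volume) (s := Set.Icc (-T) T)
    (f := fun _ => 2 * G ((2 * (2 * T))⁻¹ • u t))
    (g := fun s => (2 * T)⁻¹ * G (u s) + (2 * T)⁻¹ * K)
    (integrableOn_const (by simp)) ((hGu.const_mul _).add (integrableOn_const (by simp)))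
    measurableSet_Icc hpoint
  rw [integral_add (hGu.const_mul _) (integrableOn_const (by simp)),
    integral_const_mul (2 * T)⁻¹ (fun s => G (u s)),
    setIntegral_const, setIntegral_const, hvol, smul_eq_mul, smul_eq_mul,
    mul_inv_cancel_left₀ (by positivity)] at hmono
  have h3 := mul_le_of_le_one_left hM0 hL
  have h4 := le_mul_of_one_le_left
    (mul_nonneg zero_le_two (hGnonneg ((2 * (2 * T))⁻¹ • u t))) hI
  linarith
end

section
/- Let G : ℝ^N → [0,∞) be a G-function. Then for all k > 1, all ε with 0 < ε < 1/k, and all x, y ∈ ℝ^N, one has |G(x + y) − G(x)| ≤ ε |G(kx) − k G(x)| + 2 G(C_ε y), where C_ε = 1/(ε(k − 1)). -/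
open Filter

/-- One-sided increment bound for a convex function, obtained by writing `x + y` as a convex
combination of `x`, `k • x` and a multiple of `y`. -/
theorem ConvexOn.add_le_of_scaling {E : Type*} [AddCommGroup E] [Module ℝ E] {G : E → ℝ}
    (hG : ConvexOn ℝ Set.univ G) {k ε : ℝ} (hk : 1 < k) (hε : 0 < ε) (hεk : ε * k ≤ 1) (x y : E) :
    G (x + y) ≤ G x + ε * (G (k • x) - k * G x) +
      ε * (k - 1) * G ((1 / (ε * (k - 1))) • y) := by
  have hc : 0 < ε * (k - 1) := mul_pos hε (sub_pos.2 hk)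
  have h := hG.map_sum_le (t := Finset.univ) (w := ![1 - ε * k, ε, ε * (k - 1)])
    (p := ![x, k • x, (1 / (ε * (k - 1))) • y])
    (by
      intro i _
      fin_cases i
      · exact sub_nonneg.2 hεk
      · exact hε.le
      · exact hc.le)
    (by simp only [Fin.sum_univ_three, Matrix.cons_val]; ring)
    (fun _ _ => Set.mem_univ _)
  simp only [Fin.sum_univ_three, Matrix.cons_val, smul_eq_mul] at h
  have hxy : (1 - ε * k) • x + ε • k • x + (ε * (k - 1)) • (1 / (ε * (k - 1))) • y = x + y := by
    rw [smul_smul, smul_smul, mul_one_div_cancel hc.ne', one_smul, ← add_smul]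
    simp
  rw [hxy] at h
  linarith

/-- Brezis–Lieb type inequality for a G-function. -/
theorem brezis_lieb_ineq
    {N : ℕ} (G : EuclideanSpace ℝ (Fin N) → ℝ)
    (hGnonneg : ∀ x, 0 ≤ G x)
    (hGconvex : ConvexOn ℝ Set.univ G)
    (hGeven : ∀ x, G (-x) = G x)
    (hG0 : G 0 = 0)
    (hGsuper : Tendsto (fun x : EuclideanSpace ℝ (Fin N) => G x / ‖x‖)
      (Filter.comap norm atTop) atTop) :
    ∀ k : ℝ, 1 < k → ∀ ε : ℝ, 0 < ε → ε < 1 / k →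
      ∀ x y : EuclideanSpace ℝ (Fin N),
        |G (x + y) - G x| ≤ ε * |G (k • x) - k * G x| + 2 * G ((1 / (ε * (k - 1))) • y) := by
  intro k hk ε hε hεk x y
  have hεk' : ε * k < 1 := (lt_div_iff₀ (by linarith)).1 hεk
  have hplus := hGconvex.add_le_of_scaling hk hε hεk'.le x y
  have hminus := hGconvex.add_le_of_scaling hk hε hεk'.le x (-y)
  rw [smul_neg, hGeven] at hminus
  have hmid : G x ≤ (1 / 2) * G (x + y) + (1 / 2) * G (x + -y) := by
    have h := hGconvex.2 (Set.mem_univ (x + y)) (Set.mem_univ (x + -y))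
      (by norm_num : (0 : ℝ) ≤ 1 / 2) (by norm_num : (0 : ℝ) ≤ 1 / 2) (by norm_num)
    have hx : (1 / 2 : ℝ) • (x + y) + (1 / 2 : ℝ) • (x + -y) = x := by module
    rwa [hx] at h
  have habs := mul_le_mul_of_nonneg_left (le_abs_self (G (k • x) - k * G x)) hε.le
  have hcoef : ε * (k - 1) * G ((1 / (ε * (k - 1))) • y) ≤
      2 * G ((1 / (ε * (k - 1))) • y) :=
    mul_le_mul_of_nonneg_right (by linarith) (hGnonneg _)
  rw [abs_le]
  constructor <;> linarith
end

section
/- Let I ⊂ ℝ be a compact interval and let V, K, W : I × ℝ^N → ℝ satisfy V(t, x) = K(t, x) − W(t, x), with V(t, ·) continuously differentiable for each t and gradient V_x in the second variable. Suppose there exist M > 0, ε_V > 0, θ_V > 0 and p_K > 1 such that for all t ∈ I and all x with |x| > M one has ⟨V_x(t, x), x⟩ ≤ (θ_V − ε_V) K(t, x) − θ_V W(t, x) and W(t, x) > K(t, x) > |x|^{p_K}. Then V(t, λx) ≤ λ^{θ_V} V(t, x) for all λ ≥ 1, all t ∈ I, and all x with |x| > M. -/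
open scoped RealInnerProductSpace

/-- A superhomogeneity estimate of Euler type along a ray: if `⟪∇f (s • x), s • x⟫ ≤ θ f (s • x)`
for all `s ≥ 1`, then `f (l • x) ≤ l ^ θ * f x` for all `l ≥ 1`. -/
theorem apply_smul_le_rpow_mul_of_inner_gradient_le
    {E : Type*} [NormedAddCommGroup E] [InnerProductSpace ℝ E] [CompleteSpace E]
    {f : E → ℝ} {f' : E → E} {x : E} {θ : ℝ}
    (hf : ∀ s : ℝ, 1 ≤ s → HasGradientAt f (f' (s • x)) (s • x))
    (hle : ∀ s : ℝ, 1 ≤ s → ⟪f' (s • x), s • x⟫ ≤ θ * f (s • x))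
    {l : ℝ} (hl : 1 ≤ l) : f (l • x) ≤ l ^ θ * f x := by
  have hderiv : ∀ s : ℝ, 1 ≤ s → HasDerivAt (fun s : ℝ => s ^ (-θ) * f (s • x))
      (s ^ (-θ - 1) * (⟪f' (s • x), s • x⟫ - θ * f (s • x))) s := by
    intro s hs
    have hs0 : 0 < s := one_pos.trans_le hs
    have hray : HasDerivAt (fun s : ℝ => s • x) x s := by
      simpa using (hasDerivAt_id s).smul_const x
    have hfray : HasDerivAt (fun s : ℝ => f (s • x)) ⟪f' (s • x), x⟫ s := by
      simpa [Function.comp_def] using (hf s hs).hasFDerivAt.comp_hasDerivAt s hray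
    have hpow : HasDerivAt (fun s : ℝ => s ^ (-θ)) (-θ * s ^ (-θ - 1)) s :=
      Real.hasDerivAt_rpow_const (Or.inl hs0.ne')
    refine (hpow.mul hfray).congr_deriv ?_
    have hsplit : s ^ (-θ) = s ^ (-θ - 1) * s := by
      rw [Real.rpow_sub_one hs0.ne', div_mul_cancel₀ _ hs0.ne']
    rw [hsplit, real_inner_smul_right]
    ring
  have hanti : AntitoneOn (fun s : ℝ => s ^ (-θ) * f (s • x)) (Set.Ici 1) := by
    refine antitoneOn_of_hasDerivWithinAt_nonpos (convex_Ici 1)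
      (fun s hs => (hderiv s hs).continuousAt.continuousWithinAt)
      (fun s hs => (hderiv s (interior_subset hs)).hasDerivWithinAt) fun s hs => ?_
    have hs1 : 1 ≤ s := interior_subset (s := Set.Ici (1 : ℝ)) hs
    exact mul_nonpos_of_nonneg_of_nonpos (Real.rpow_nonneg (zero_le_one.trans hs1) _)
      (sub_nonpos.2 (hle s hs1))
  have hl0 : 0 < l := one_pos.trans_le hl
  have h := hanti Set.self_mem_Ici hl hl
  simp only [Real.one_rpow, one_smul, one_mul] at h
  rwa [Real.rpow_neg hl0.le, inv_mul_le_iff₀ (Real.rpow_pos_of_pos hl0 θ)] at h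

/-- If `V = K - W` satisfies the Ambrosetti–Rabinowitz type condition
`⟨V_x(t,x),x⟩ ≤ (θ_V - ε_V) K(t,x) - θ_V W(t,x)` and `W(t,x) > K(t,x) > |x|^{p_K}`
for `|x| > M`, then `V(t,λx) ≤ λ^{θ_V} V(t,x)` for all `λ ≥ 1` and `|x| > M`. -/
theorem V_scaling_ineq
    {N : ℕ} (a b : ℝ) (hab : a ≤ b)
    (V K W : ℝ → EuclideanSpace ℝ (Fin N) → ℝ)
    (Vx : ℝ → EuclideanSpace ℝ (Fin N) → EuclideanSpace ℝ (Fin N))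
    (hVKW : ∀ t ∈ Set.Icc a b, ∀ x : EuclideanSpace ℝ (Fin N), V t x = K t x - W t x)
    (hdiff : ∀ t ∈ Set.Icc a b, ∀ x : EuclideanSpace ℝ (Fin N),
      HasGradientAt (fun x' => V t x') (Vx t x) x)
    (hcont : ∀ t ∈ Set.Icc a b, Continuous (Vx t))
    (M εV θV pK : ℝ) (hM : 0 < M) (hεV : 0 < εV) (hθV : 0 < θV) (hpK : 1 < pK)
    (hAR : ∀ t ∈ Set.Icc a b, ∀ x : EuclideanSpace ℝ (Fin N), M < ‖x‖ →
      ⟪Vx t x, x⟫ ≤ (θV - εV) * K t x - θV * W t x)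
    (hWK : ∀ t ∈ Set.Icc a b, ∀ x : EuclideanSpace ℝ (Fin N), M < ‖x‖ →
      K t x < W t x ∧ ‖x‖ ^ pK < K t x) :
    ∀ lam : ℝ, 1 ≤ lam → ∀ t ∈ Set.Icc a b, ∀ x : EuclideanSpace ℝ (Fin N), M < ‖x‖ →
      V t (lam • x) ≤ lam ^ θV * V t x := by
  intro lam hlam t ht x hx
  refine apply_smul_le_rpow_mul_of_inner_gradient_le (f := V t) (f' := Vx t)
    (fun s _ => hdiff t ht (s • x)) (fun s hs => ?_) hlam
  have hsx : M < ‖s • x‖ := by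
    rw [norm_smul, Real.norm_of_nonneg (zero_le_one.trans hs)]
    exact hx.trans_le (le_mul_of_one_le_left (norm_nonneg x) hs)
  have hK : 0 < K t (s • x) :=
    (Real.rpow_nonneg (norm_nonneg _) pK).trans_lt (hWK t ht _ hsx).2
  rw [hVKW t ht]
  linarith [hAR t ht _ hsx, mul_pos hεV hK]
end

section
/- (Ekeland's variational principle.) Let (V, d) be a complete metric space and let J : V → ℝ ∪ {+∞} be lower semicontinuous, bounded from below, and not identically +∞. Let u ∈ V and ε > 0 be such that J(u) ≤ inf_{v ∈ V} J(v) + ε. Then for every δ > 0 there exists a point v ∈ V such that (i) J(v) ≤ J(u), (ii) d(u, v) ≤ δ, and (iii) J(w) > J(v) − (ε/δ) d(v, w) for every w ≠ v. -/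
/-- A nonempty set of points on which `f` is bounded below contains, for each of its points `v`, a
point that closes at least half of the gap between `f v` and the infimum of `f`. -/
theorem exists_two_mul_le_add_of_bddBelow {α : Type*} (f : α → ℝ) {s : Set α} {c : ℝ}
    (hc : ∀ z ∈ s, c ≤ f z) {v : α} (hv : v ∈ s) :
    ∃ w ∈ s, ∀ z ∈ s, 2 * f w ≤ f v + f z := by
  have hbdd : BddBelow (f '' s) := ⟨c, by rintro _ ⟨z, hz, rfl⟩; exact hc z hz⟩
  have hle : ∀ z ∈ s, sInf (f '' s) ≤ f z := fun z hz => csInf_le hbdd ⟨z, hz, rfl⟩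
  rcases (hle v hv).eq_or_lt with h | h
  · exact ⟨v, hv, fun z hz => by linarith [hle z hz]⟩
  · obtain ⟨_, ⟨w, hw, rfl⟩, hlt⟩ := exists_lt_of_csInf_lt (s := f '' s) ⟨_, v, hv, rfl⟩
      (show sInf (f '' s) < (f v + sInf (f '' s)) / 2 by linarith)
    exact ⟨w, hw, fun z hz => by linarith [hle z hz]⟩

/-- A lower semicontinuous function bounded below by a real number on a complete metric space
admits, below any point `u` of its domain, a point `v` that is minimal for the order
`J w + k * dist v w ≤ J v`. -/
theorem LowerSemicontinuous.exists_forall_sub_mul_dist_lt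
    {V : Type*} [MetricSpace V] [CompleteSpace V] {J : V → EReal}
    (hJ : LowerSemicontinuous J) {c : ℝ} (hc : ∀ v, (c : EReal) ≤ J v)
    {k : ℝ} (hk : 0 < k) {u : V} (hu : J u ≠ ⊤) :
    ∃ v : V, J v ≤ (((J u).toReal - k * dist u v : ℝ) : EReal) ∧
      ∀ w : V, w ≠ v → (((J v).toReal - k * dist v w : ℝ) : EReal) < J w := by
  let f : V → ℝ := fun v => (J v).toReal
  let S : V → Set V := fun v => {w | J w ≤ ((f v - k * dist v w : ℝ) : EReal)}
  have hbot : ∀ v, J v ≠ ⊥ := fun v h => by simpa [h] using hc v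
  have htop : ∀ {v w}, w ∈ S v → J w ≠ ⊤ := fun {v w} h =>
    (lt_of_le_of_lt h (EReal.coe_lt_top _)).ne
  have hcoe : ∀ {v}, J v ≠ ⊤ → ((f v : ℝ) : EReal) = J v := fun {v} h =>
    EReal.coe_toReal h (hbot v)
  have hreal : ∀ {v w}, w ∈ S v → f w ≤ f v - k * dist v w := fun {v w} h => by
    have h' : J w ≤ ((f v - k * dist v w : ℝ) : EReal) := h
    rw [← hcoe (htop h)] at h'
    exact_mod_cast h'
  have hcf : ∀ {v}, J v ≠ ⊤ → c ≤ f v := fun {v} h => by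
    have h' := hc v
    rw [← hcoe h] at h'
    exact_mod_cast h'
  have hself : ∀ {v}, J v ≠ ⊤ → v ∈ S v := fun {v} h => by
    change J v ≤ ((f v - k * dist v v : ℝ) : EReal)
    simp [hcoe h]
  have htrans : ∀ {x y z}, y ∈ S x → z ∈ S y → z ∈ S x := fun {x y z} hy hz => by
    refine le_trans (show J z ≤ ((f y - k * dist y z : ℝ) : EReal) from hz) ?_
    have h1 := hreal hy
    have h2 := mul_le_mul_of_nonneg_left (dist_triangle x y z) hk.le
    exact_mod_cast (by linarith : f y - k * dist y z ≤ f x - k * dist x z)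
  have hstep : ∀ v : {v // J v ≠ ⊤}, ∃ w : {v // J v ≠ ⊤},
      w.1 ∈ S v.1 ∧ ∀ z ∈ S v.1, 2 * f w ≤ f v + f z := fun v => by
    obtain ⟨w, hw, h⟩ := exists_two_mul_le_add_of_bddBelow f (s := S v.1)
      (fun z hz => hcf (htop hz)) (hself v.2)
    exact ⟨⟨w, htop hw⟩, hw, h⟩
  choose g hgS hg using hstep
  let x : ℕ → {v // J v ≠ ⊤} := fun n => g^[n] ⟨u, hu⟩
  have hx : ∀ n, x (n + 1) = g (x n) := fun n => Function.iterate_succ_apply' g n _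
  have hmem : ∀ n m, n ≤ m → (x m).1 ∈ S (x n).1 := fun n m h => by
    induction m, h using Nat.le_induction with
    | base => exact hself (x n).2
    | succ m _ ih => exact htrans ih (hx m ▸ hgS (x m))
  have hanti : Antitone fun n => f (x n) := fun n m h => by
    have := hreal (hmem n m h)
    have := mul_nonneg hk.le (dist_nonneg (x := (x n).1) (y := (x m).1))
    dsimp only
    linarith
  have hbdd : BddBelow (Set.range fun n => f (x n)) :=
    ⟨c, by rintro _ ⟨n, rfl⟩; exact hcf (x n).2⟩
  have hlim := tendsto_atTop_ciInf hanti hbdd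
  set L := ⨅ n, f (x n)
  have hcauchy : CauchySeq fun n => (x n).1 := by
    refine cauchySeq_of_le_tendsto_0 (fun n => 2 * ((f (x n) - L) / k)) ?_ ?_
    · intro n m N hn hm
      have h : ∀ j, N ≤ j → dist (x N).1 (x j).1 ≤ (f (x N) - L) / k := fun j hj => by
        rw [le_div_iff₀ hk]
        have h1 := hreal (hmem N j hj)
        have h2 : L ≤ f (x j) := ciInf_le hbdd j
        linarith
      have := dist_triangle_left (x n).1 (x m).1 (x N).1
      linarith [h n hn, h m hm]
    · simpa using (((hlim.sub_const L).div_const k).const_mul 2)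
  obtain ⟨v, hv⟩ := cauchySeq_tendsto_of_complete hcauchy
  have hvS : ∀ n, v ∈ S (x n).1 := fun n => by
    change J v ≤ ((f (x n) - k * dist (x n).1 v : ℝ) : EReal)
    by_contra! hlt
    obtain ⟨b, hb, hbv⟩ := EReal.lt_iff_exists_real_btwn.1 hlt
    have h1 := hv.eventually (hJ v b hbv)
    have h2 : Filter.Tendsto (fun m => f (x n) - k * dist (x n).1 (x m).1) Filter.atTop
        (nhds (f (x n) - k * dist (x n).1 v)) :=
      ((tendsto_const_nhds.dist hv).const_mul k).const_sub _
    have h3 := h2.eventually (gt_mem_nhds (EReal.coe_lt_coe_iff.1 hb))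
    obtain ⟨m, h1, h3, hm⟩ := (h1.and (h3.and (Filter.eventually_ge_atTop n))).exists
    rw [← hcoe (x m).2] at h1
    linarith [hreal (hmem n m hm), EReal.coe_lt_coe_iff.1 h1]
  refine ⟨v, hvS 0, fun w hw => ?_⟩
  by_contra! hle
  have hwv : w ∈ S v := hle
  have hLw : L ≤ f w := by
    have h := le_of_tendsto_of_tendsto' ((hlim.comp (Filter.tendsto_add_atTop_nat 1)).const_mul 2)
      (hlim.add_const (f w)) fun n => by
        simpa [hx] using hg (x n) w (htrans (hvS n) hwv)
    linarith
  have hvL : f v ≤ L := le_ciInf fun n => by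
    have := hreal (hvS n)
    have := mul_nonneg hk.le (dist_nonneg (x := (x n).1) (y := v))
    linarith
  linarith [hreal hwv, mul_pos hk (dist_pos.2 hw.symm)]

/-- Ekeland's variational principle. -/
theorem ekeland_variational_principle
    {V : Type*} [MetricSpace V] [CompleteSpace V]
    (J : V → EReal) (hJbot : ∀ v, J v ≠ ⊥)
    (hJlsc : LowerSemicontinuous J)
    (hJbdd : ∃ c : ℝ, ∀ v, (c : EReal) ≤ J v)
    (hJne : ∃ v, J v ≠ ⊤)
    (u : V) (ε : ℝ) (hε : 0 < ε)
    (hu : J u ≤ sInf (Set.range J) + (ε : EReal)) :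
    ∀ δ : ℝ, 0 < δ → ∃ v : V,
      J v ≤ J u ∧ dist u v ≤ δ ∧
      ∀ w : V, w ≠ v → J v - (((ε / δ) * dist v w : ℝ) : EReal) < J w := by
  intro δ hδ
  obtain ⟨c, hc⟩ := hJbdd
  have hu' : ∀ v, J v ≠ ⊤ → J u ≤ (((J v).toReal + ε : ℝ) : EReal) := fun v hv => by
    rw [EReal.coe_add, EReal.coe_toReal hv (hJbot v)]
    have h : sInf (Set.range J) ≤ J v := sInf_le (Set.mem_range_self v)
    exact hu.trans (by gcongr)
  obtain ⟨v₀, hv₀⟩ := hJne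
  have hutop : J u ≠ ⊤ := ((hu' v₀ hv₀).trans_lt (EReal.coe_lt_top _)).ne
  have hk : 0 < ε / δ := div_pos hε hδ
  obtain ⟨v, hvu, hv⟩ := hJlsc.exists_forall_sub_mul_dist_lt hc hk hutop
  have hvtop : J v ≠ ⊤ := (hvu.trans_lt (EReal.coe_lt_top _)).ne
  have hJu := EReal.coe_toReal hutop (hJbot u)
  have hJv := EReal.coe_toReal hvtop (hJbot v)
  refine ⟨v, ?_, ?_, fun w hw => ?_⟩
  · refine hvu.trans ?_
    conv_rhs => rw [← hJu]
    exact EReal.coe_le_coe_iff.2 (sub_le_self _ (by positivity))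
  · have h1 := hu' v hvtop
    rw [← hJu, EReal.coe_le_coe_iff] at h1
    rw [← hJv, EReal.coe_le_coe_iff] at hvu
    have h2 : ε / δ * dist u v ≤ ε / δ * δ := by
      rw [div_mul_cancel₀ ε hδ.ne']
      linarith
    exact le_of_mul_le_mul_left h2 hk
  · have h := hv w hw
    rwa [EReal.coe_sub, hJv] at h
end
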